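/- Let d ≥ 2, let 1 ≤ n < d, let ρ be a positive semidefinite matrix on ℂ^d ⊗ ℂ^d, and let α be real with -1 ≤ α ≤ 2(dn-1)/(d-n). Then the matrix Tr(ρ)·𝟙_{d²} + α·ρ has Schmidt number at most n. -/

import Mathlib

open Matrix
open scoped ComplexOrder

/-- A positive semidefinite matrix σ on ℂ^d ⊗ ℂ^d has Schmidt number at most n if it is a
finite sum of rank-one projectors v v† onto vectors v that are sums of at most n simple
tensors. -/
def SchmidtNumberLE {d : ℕ}
    (σ : Matrix (Fin d × Fin d) (Fin d × Fin d) ℂ) (n : ℕ) : Prop :=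
  ∃ (k : ℕ) (v : Fin k → (Fin d × Fin d → ℂ)),
    (∀ i, ∃ (e : Fin n → (Fin d → ℂ)) (f : Fin n → (Fin d → ℂ)),
        v i = ∑ l, (fun p => e l p.1 * f l p.2)) ∧
    σ = ∑ i, Matrix.vecMulVec (v i) (star (v i))

namespace SchmidtNumberLE

variable {d n : ℕ} {σ τ : Matrix (Fin d × Fin d) (Fin d × Fin d) ℂ}

theorem zero : SchmidtNumberLE (0 : Matrix (Fin d × Fin d) (Fin d × Fin d) ℂ) n :=
  ⟨0, Fin.elim0, fun i => i.elim0, by simp⟩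

theorem add (hσ : SchmidtNumberLE σ n) (hτ : SchmidtNumberLE τ n) :
    SchmidtNumberLE (σ + τ) n := by
  obtain ⟨k, v, hv, rfl⟩ := hσ
  obtain ⟨l, w, hw, rfl⟩ := hτ
  refine ⟨k + l, Fin.append v w, fun i => ?_, ?_⟩
  · induction i using Fin.addCases with
    | left i => simpa only [Fin.append_left] using hv i
    | right i => simpa only [Fin.append_right] using hw i
  · simp only [Fin.sum_univ_add, Fin.append_left, Fin.append_right]

theorem sum {ι : Type*} (s : Finset ι) {σ : ι → Matrix (Fin d × Fin d) (Fin d × Fin d) ℂ}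
    (h : ∀ i ∈ s, SchmidtNumberLE (σ i) n) : SchmidtNumberLE (∑ i ∈ s, σ i) n :=
  Finset.sum_induction σ (SchmidtNumberLE · n) (fun _ _ => add) zero h

/-- The rank-one projector onto a sum of at most `n` simple tensors. -/
theorem of_sum_tensor {ι : Type*} (s : Finset ι) (hs : s.card ≤ n) (e f : ι → Fin d → ℂ)
    {v : Fin d × Fin d → ℂ} (hv : v = ∑ l ∈ s, fun p => e l p.1 * f l p.2) :
    SchmidtNumberLE (vecMulVec v (star v)) n := by
  refine ⟨1, fun _ => v, fun _ => ?_, by simp⟩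
  obtain ⟨j⟩ : Nonempty (s ↪ Fin n) := Function.Embedding.nonempty_of_card_le (by simpa using hs)
  refine ⟨Function.extend j (fun l => e l) 0, Function.extend j (fun l => f l) 0, ?_⟩
  rw [hv, ← Finset.sum_coe_sort]
  refine Fintype.sum_of_injective j j.injective _ _ (fun i hi => ?_) fun i => ?_
  · ext p
    have hi : ¬∃ l, j l = i := hi
    simp [Function.extend_apply' _ _ i hi]
  · simp [j.injective.extend_apply]

/-- Local operations do not increase the Schmidt number. -/
theorem kronecker_conj (h : SchmidtNumberLE σ n) (X Y : Matrix (Fin d) (Fin d) ℂ) :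
    SchmidtNumberLE (kroneckerMap (· * ·) X Y * σ * (kroneckerMap (· * ·) X Y)ᴴ) n := by
  obtain ⟨k, v, hv, rfl⟩ := h
  refine ⟨k, fun i => kroneckerMap (· * ·) X Y *ᵥ v i, fun i => ?_, ?_⟩
  · obtain ⟨e, f, hef⟩ := hv i
    refine ⟨fun l => X *ᵥ e l, fun l => Y *ᵥ f l, ?_⟩
    ext p
    simp only [hef, mulVec, dotProduct, Finset.sum_apply, kroneckerMap_apply, Fintype.sum_prod_type,
      Finset.mul_sum, Finset.sum_mul]
    rw [Finset.sum_congr rfl fun _ _ => Finset.sum_comm, Finset.sum_comm]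
    refine Finset.sum_congr rfl fun l _ => ?_
    rw [Finset.sum_comm]
    refine Finset.sum_congr rfl fun i _ => Finset.sum_congr rfl fun j _ => by ring
  · simp only [Finset.mul_sum, Finset.sum_mul, mul_vecMulVec, vecMulVec_mul, star_mulVec]

theorem smul (h : SchmidtNumberLE σ n) {r : ℝ} (hr : 0 ≤ r) :
    SchmidtNumberLE ((r : ℂ) • σ) n := by
  convert h.kronecker_conj ((√r : ℂ) • (1 : Matrix (Fin d) (Fin d) ℂ)) 1 using 1
  have : kroneckerMap (· * ·) ((√r : ℂ) • (1 : Matrix (Fin d) (Fin d) ℂ))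
      (1 : Matrix (Fin d) (Fin d) ℂ) = (√r : ℂ) • 1 := by
    rw [Matrix.smul_kronecker, Matrix.one_kronecker_one]
  rw [this, conjTranspose_smul]
  simp [smul_smul, Real.mul_self_sqrt hr]

theorem single_self (hn : 1 ≤ n) (p : Fin d × Fin d) :
    SchmidtNumberLE (Matrix.single p p (1 : ℂ)) n := by
  convert of_sum_tensor (n := n) (d := d) {()} (by simpa using hn) (fun _ => Pi.single p.1 1)
    (fun _ => Pi.single p.2 1) (v := Pi.single p 1) ?_ using 1
  · rw [single_eq_single_vecMulVec_single]
    simp [Pi.star_single]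
  · ext q
    simp only [Finset.sum_singleton, Pi.single_apply, Prod.ext_iff]
    split_ifs <;> simp_all

theorem diagonal (hn : 1 ≤ n) {w : Fin d × Fin d → ℝ} (hw : ∀ p, 0 ≤ w p) :
    SchmidtNumberLE (Matrix.diagonal fun p => (w p : ℂ)) n := by
  have : (Matrix.diagonal fun p => (w p : ℂ)) = ∑ p, (w p : ℂ) • Matrix.single p p (1 : ℂ) := by
    ext p q
    simp only [Matrix.diagonal_apply, Matrix.sum_apply, Matrix.smul_apply, Matrix.single_apply,
      smul_eq_mul, mul_ite, mul_one, mul_zero]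
    by_cases h : p = q <;> simp [h, ite_and]
  rw [this]
  exact sum _ fun p _ => (single_self hn p).smul (hw p)

/-- Averaging the projectors onto `∑ m ∈ s, v m` over all `n`-element subsets `s`, where the `v m`
are simple tensors. -/
theorem subset_average (hn : 2 ≤ n) (hnd : n ≤ d) (e f : Fin d → Fin d → ℂ)
    {v : Fin d → Fin d × Fin d → ℂ} (hv : ∀ m p, v m p = e m p.1 * f m p.2) :
    SchmidtNumberLE (((n : ℂ) - 1) • vecMulVec (∑ m, v m) (star (∑ m, v m)) +
      ((d : ℂ) - n) • ∑ m, vecMulVec (v m) (star (v m))) n := by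
  have hcard (m m' : Fin d) : ((Finset.powersetCard n Finset.univ).filter
      fun s : Finset (Fin d) => m ∈ s ∧ m' ∈ s).card =
        if m = m' then (d - 1).choose (n - 1) else (d - 2).choose (n - 2) := by
    have hle : ({m, m'} : Finset (Fin d)).card ≤ n := Finset.card_le_two.trans hn
    have := Finset.card_filter_powersetCard_subset {m, m'} Finset.univ n (Finset.subset_univ _) hle
    simp only [Finset.insert_subset_iff, Finset.singleton_subset_iff, Finset.card_univ,
      Fintype.card_fin] at this
    rw [this]
    split_ifs with h
    · simp [h]
    · rw [Finset.card_pair h]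
  obtain ⟨a, rfl⟩ := Nat.exists_eq_add_of_le' hn
  obtain ⟨b, rfl⟩ := Nat.exists_eq_add_of_le' (hn.trans hnd)
  have hchoose : ((b : ℂ) + 1) * (b.choose a) = (b + 1).choose (a + 1) * ((a : ℂ) + 1) := by
    exact_mod_cast Nat.add_one_mul_choose_eq b a
  have hpos : ((b + 1).choose (a + 1) : ℂ) ≠ 0 := by
    exact_mod_cast (Nat.choose_pos (by omega)).ne'
  have key := (sum (Finset.powersetCard (a + 2) Finset.univ)
    (σ := fun s => vecMulVec (∑ m ∈ s, v m) (star (∑ m ∈ s, v m))) (n := a + 2) fun s hs =>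
      of_sum_tensor s (Finset.mem_powersetCard.1 hs).2.le e f
        (Finset.sum_congr rfl fun m _ => funext (hv m))).smul
      (r := (b + 1) / (b + 1).choose (a + 1)) (by positivity)
  convert key using 1
  ext p q
  have expand (s : Finset (Fin (b + 2))) : (∑ m ∈ s, v m p) * ∑ m ∈ s, star (v m q) =
      ∑ m, ∑ m', (if m ∈ s ∧ m' ∈ s then 1 else 0) * (v m p * star (v m' q)) := by
    simp [ite_and, Finset.sum_ite_mem, Finset.sum_mul_sum]
  have total : ∑ s ∈ Finset.powersetCard (a + 2) Finset.univ,
      (∑ m ∈ s, v m p) * ∑ m ∈ s, star (v m q) =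
      ∑ m, ∑ m', (if m = m' then ((b + 1).choose (a + 1) : ℂ) else b.choose a) *
        (v m p * star (v m' q)) := by
    simp_rw [expand]
    rw [Finset.sum_comm]
    refine Finset.sum_congr rfl fun m _ => ?_
    rw [Finset.sum_comm]
    refine Finset.sum_congr rfl fun m' _ => ?_
    rw [← Finset.sum_mul, Finset.sum_boole, hcard]
    split_ifs <;> rfl
  simp only [Matrix.add_apply, Matrix.smul_apply, Matrix.sum_apply, vecMulVec_apply, Pi.star_apply,
    smul_eq_mul, Finset.sum_apply, star_sum, total]
  have ratio (m m' : Fin (b + 2)) : ((b : ℂ) + 1) / (b + 1).choose (a + 1) *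
      (if m = m' then ((b + 1).choose (a + 1) : ℂ) else b.choose a) =
      (a + 2 - 1) + if m = m' then (b + 2 - (a + 2) : ℂ) else 0 := by
    split_ifs
    · field_simp
      ring
    · rw [div_mul_eq_mul_div, hchoose]
      field_simp
      ring
  push_cast
  simp_rw [Finset.sum_mul_sum, Finset.mul_sum, ← mul_assoc, ratio, add_mul,
    Finset.sum_add_distrib, ite_mul, zero_mul, Finset.sum_ite_eq, Finset.mem_univ, if_true]

/-- Keep the entries fixed by conjugation with all `D ⊗ star D`, `D` a diagonal unitary. -/
def torusTwirl (σ : Matrix (Fin d × Fin d) (Fin d × Fin d) ℂ) :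
    Matrix (Fin d × Fin d) (Fin d × Fin d) ℂ :=
  Matrix.of fun p q => if (p.1 = p.2 ∧ q.1 = q.2) ∨ p = q then σ p q else 0

theorem sum_phase (p q : Fin d × Fin d) :
    ∑ g : Fin d → ZMod 3, ZMod.stdAddChar (g p.1 - g p.2 - g q.1 + g q.2) =
      if (p.1 = p.2 ∧ q.1 = q.2) ∨ p = q then (3 : ℂ) ^ d else 0 := by
  split_ifs with h
  · have (g : Fin d → ZMod 3) : g p.1 - g p.2 - g q.1 + g q.2 = 0 := by
      rcases h with ⟨h1, h2⟩ | rfl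
      · simp [h1, h2]
      · ring
    simp [this]
  · let ev (i : Fin d) : (Fin d → ZMod 3) →+ ZMod 3 := Pi.evalAddMonoidHom (fun _ => ZMod 3) i
    let φ : (Fin d → ZMod 3) →+ ZMod 3 := ev p.1 - ev p.2 - ev q.1 + ev q.2
    refine (AddChar.sum_eq_zero_iff_ne_zero (ψ := ZMod.stdAddChar.compAddMonoidHom φ)).2
      fun h0 => ?_
    have hφ (m : Fin d) : φ (Pi.single m 1) = 0 := by
      apply ZMod.injective_stdAddChar
      have := DFunLike.congr_fun h0 (Pi.single m 1)
      simpa using this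
    simp only [φ, ev, AddMonoidHom.add_apply, AddMonoidHom.sub_apply, Pi.evalAddMonoidHom_apply,
      Pi.single_apply] at hφ
    obtain ⟨i, j⟩ := p
    obtain ⟨k, l⟩ := q
    simp only [Prod.mk.injEq, not_or, not_and] at h
    by_cases hij : i = j
    · have hk := hφ k
      have hl : l ≠ k := Ne.symm (h.1 hij)
      simp [hij, hl] at hk
    · have hi := hφ i
      have hj := hφ j
      have hji : j ≠ i := Ne.symm hij
      have key : (1 : ZMod 3) + 1 ≠ 0 := by decide
      by_cases hk : k = i
      · have hl : l ≠ j := fun hl => h.2 hk.symm hl.symm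
        simp [hij, hk, hl] at hj
      · by_cases hl : l = i
        · simp [hji, hk, hl, key] at hi
        · simp [hji, hk, hl] at hi

theorem twirl (h : SchmidtNumberLE σ n) : SchmidtNumberLE (torusTwirl σ) n := by
  let D (g : Fin d → ZMod 3) (c : ZMod 3) : Matrix (Fin d) (Fin d) ℂ :=
    Matrix.diagonal fun i => ZMod.stdAddChar (c * g i)
  have key := (sum Finset.univ fun (g : Fin d → ZMod 3) _ =>
    h.kronecker_conj (D g 1) (D g (-1))).smul (r := ((3 : ℝ) ^ d)⁻¹) (by positivity)
  convert key using 1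
  ext p q
  have (g : Fin d → ZMod 3) : (kroneckerMap (· * ·) (D g 1) (D g (-1)) * σ *
      (kroneckerMap (· * ·) (D g 1) (D g (-1)))ᴴ) p q =
      ZMod.stdAddChar (g p.1 - g p.2 - g q.1 + g q.2) * σ p q := by
    simp only [D, kroneckerMap_diagonal_diagonal _ zero_mul mul_zero, diagonal_conjTranspose,
      mul_diagonal, diagonal_mul, Pi.star_apply, star_mul']
    simp only [← starRingEnd_apply, ← AddChar.map_neg_eq_conj]
    rw [mul_right_comm, ← AddChar.map_add_eq_mul, ← AddChar.map_add_eq_mul,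
      ← AddChar.map_add_eq_mul]
    ring_nf
  simp only [torusTwirl, of_apply, Matrix.smul_apply, Matrix.sum_apply, this, ← Finset.sum_mul,
    sum_phase]
  split_ifs <;> simp

/-- The vector `∑ i, x i • (eᵢ ⊗ eᵢ)`. -/
def diagVec (x : Fin d → ℝ) : Fin d × Fin d → ℂ :=
  fun p => if p.1 = p.2 then (x p.1 : ℂ) else 0

theorem vecMulVec_diagVec (x : Fin d → ℝ) (p q : Fin d × Fin d) :
    vecMulVec (diagVec x) (star (diagVec x)) p q =
      if p.1 = p.2 ∧ q.1 = q.2 then ((x p.1 * x q.1 : ℝ) : ℂ) else 0 := by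
  simp only [vecMulVec_apply, diagVec, Pi.star_apply]
  by_cases hp : p.1 = p.2 <;> by_cases hq : q.1 = q.2 <;> simp [hp, hq]

theorem of_diagVec (s : Finset (Fin d)) (hs : s.card ≤ n) {x : Fin d → ℝ}
    (hx : ∀ i ∉ s, x i = 0) :
    SchmidtNumberLE (vecMulVec (diagVec x) (star (diagVec x))) n := by
  refine of_sum_tensor s hs (fun l => Pi.single l (x l : ℂ)) (fun l => Pi.single l 1) ?_
  ext ⟨i, j⟩
  simp only [diagVec, Finset.sum_apply, Pi.single_apply, mul_ite, mul_one, mul_zero, ← ite_and]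
  by_cases hij : i = j
  · subst hij
    by_cases hi : i ∈ s <;> simp [hi, hx]
  · rw [Finset.sum_eq_zero fun l _ => if_neg ?_, if_neg hij]
    rintro ⟨rfl, rfl⟩
    exact hij rfl

/-- The `d`-dimensional discrete Fourier matrix. -/
theorem exists_fourier (d : ℕ) : ∃ F : Fin d → Fin d → ℂ, (∀ m i, F m i * star (F m i) = 1) ∧
    ∀ i j, ∑ m, F m i * star (F m j) = if i = j then (d : ℂ) else 0 := by
  rcases Nat.eq_zero_or_pos d with rfl | hd
  · exact ⟨0, fun m => m.elim0, fun i => i.elim0⟩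
  have hω := Complex.isPrimitiveRoot_exp d hd.ne'
  set ω := Complex.exp (2 * Real.pi * Complex.I / d)
  have hω0 : ω ≠ 0 := hω.ne_zero hd.ne'
  have hstar : star ω = ω⁻¹ := by
    rw [Complex.inv_def, Complex.normSq_eq_norm_sq, hω.norm'_eq_one hd.ne']
    simp
  refine ⟨fun m i => (ω ^ (i : ℕ)) ^ (m : ℕ), fun m i => ?_, fun i j => ?_⟩
  · rw [star_pow, star_pow, hstar, inv_pow, inv_pow, mul_inv_cancel₀]
    exact pow_ne_zero _ (pow_ne_zero _ hω0)
  · simp only [star_pow, hstar, ← mul_pow]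
    rw [Fin.sum_univ_eq_sum_range fun m => (ω ^ (i : ℕ) * ω⁻¹ ^ (j : ℕ)) ^ m]
    split_ifs with hij
    · simp [hij, hω0]
    · have hne : ω ^ (i : ℕ) * ω⁻¹ ^ (j : ℕ) - 1 ≠ 0 := by
        rw [inv_pow, ← div_eq_mul_inv, sub_ne_zero, Ne, div_eq_one_iff_eq (pow_ne_zero _ hω0)]
        exact fun h => hij (Fin.ext (hω.pow_inj i.2 j.2 h))
      have := mul_geom_sum (ω ^ (i : ℕ) * ω⁻¹ ^ (j : ℕ)) d
      have hpow : (ω ^ (i : ℕ) * ω⁻¹ ^ (j : ℕ)) ^ d = 1 := by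
        rw [mul_pow, pow_right_comm, pow_right_comm ω⁻¹, inv_pow, hω.pow_eq_one]
        simp
      rw [hpow, sub_self] at this
      exact (mul_eq_zero.1 this).resolve_left hne

/-- An isotropic state of Schmidt number at most `n`. -/
theorem isotropic (hn : 2 ≤ n) (hnd : n ≤ d) :
    SchmidtNumberLE (((d : ℂ) * n - 1) • vecMulVec (diagVec (1 : Fin d → ℝ)) (star (diagVec 1)) +
      ((d : ℂ) - n) • (1 : Matrix (Fin d × Fin d) (Fin d × Fin d) ℂ)) n := by
  obtain ⟨F, hF1, hF⟩ := exists_fourier d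
  have hd : (d : ℂ) ≠ 0 := by
    have : d ≠ 0 := by omega
    exact_mod_cast this
  let v (m : Fin d) (p : Fin d × Fin d) : ℂ := if p.1 = m ∧ p.2 = m then 1 else 0
  let w (m : Fin d) (p : Fin d × Fin d) : ℂ := F m p.1 * star (F m p.2)
  have hv (p) : (∑ m, v m) p = if p.1 = p.2 then 1 else 0 := by
    simp [v, ite_and, eq_comm]
  have hvv (p q) : (∑ m, vecMulVec (v m) (star (v m))) p q =
      if p = q ∧ p.1 = p.2 then 1 else 0 := by
    simp only [v, Matrix.sum_apply, vecMulVec_apply, Pi.star_apply]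
    rw [Finset.sum_eq_single p.1 (by simp +contextual [eq_comm]) (by simp)]
    simp only [apply_ite star, star_one, star_zero, Prod.ext_iff]
    grind
  have hw (p) : (∑ m, w m) p = if p.1 = p.2 then (d : ℂ) else 0 := by
    rw [Finset.sum_apply]
    exact hF p.1 p.2
  have hww (p q) (h : (p.1 = p.2 ∧ q.1 = q.2) ∨ p = q) :
      (∑ m, vecMulVec (w m) (star (w m))) p q = d := by
    have hm (m : Fin d) : vecMulVec (w m) (star (w m)) p q = 1 := by
      simp only [w, vecMulVec_apply, Pi.star_apply, star_mul', star_star]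
      rcases h with ⟨hp, hq⟩ | rfl
      · rw [hp, hq, hF1, mul_comm, mul_one, mul_comm, hF1]
      · linear_combination F m p.2 * star (F m p.2) * hF1 m p.1 + hF1 m p.2
    simp [Matrix.sum_apply, hm]
  have std := subset_average hn hnd (fun m => Pi.single m 1) (fun m => Pi.single m 1)
    (v := v) (fun m p => by simp only [v, Pi.single_apply]; split_ifs <;> simp_all)
  have fourier := ((subset_average hn hnd F (fun m i => star (F m i))
    (v := w) fun m p => rfl).twirl).smul (r := (d : ℝ)⁻¹) (by positivity)
  convert std.add fourier using 1
  ext p q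
  simp only [vecMulVec_diagVec, torusTwirl, Matrix.add_apply, Matrix.smul_apply, of_apply,
    smul_eq_mul, Matrix.one_apply, hvv, Pi.one_apply]
  simp only [vecMulVec_apply, Pi.star_apply, hv, hw]
  push_cast
  by_cases h : (p.1 = p.2 ∧ q.1 = q.2) ∨ p = q
  · rw [if_pos h, hww p q h]
    by_cases hpq : p = q
    · subst hpq
      by_cases hp : p.1 = p.2 <;> simp [hp] <;> field_simp
      ring
    · obtain ⟨hp, hq⟩ := h.resolve_right hpq
      simp [hp, hq, hpq]
      field_simp
      ring
  · rw [if_neg h]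
    simp only [not_or, not_and] at h
    by_cases hp : p.1 = p.2
    · simp [hp, h.1 hp, h.2]
    · simp [hp, h.2]

theorem filtered_isotropic (hn : 2 ≤ n) (hnd : n ≤ d) {x : Fin d → ℝ} (hx : ∀ i, 0 ≤ x i) :
    SchmidtNumberLE (((d : ℂ) * n - 1) • vecMulVec (diagVec x) (star (diagVec x)) +
      ((d : ℂ) - n) • Matrix.diagonal fun p => ((x p.1 * x p.2 : ℝ) : ℂ)) n := by
  let D : Matrix (Fin d) (Fin d) ℂ := Matrix.diagonal fun i => (√(x i) : ℂ)
  convert (isotropic hn hnd).kronecker_conj D D using 1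
  have hxx (i : Fin d) : (√(x i) : ℂ) * √(x i) = x i := by
    rw [← Complex.ofReal_mul, Real.mul_self_sqrt (hx i)]
  ext ⟨i, j⟩ ⟨k, l⟩
  simp only [D, kroneckerMap_diagonal_diagonal _ zero_mul mul_zero, diagonal_conjTranspose,
      mul_diagonal, diagonal_mul, Pi.star_apply, star_mul', vecMulVec_diagVec, Matrix.add_apply,
      Matrix.smul_apply, Matrix.one_apply, Matrix.diagonal_apply, Prod.mk.injEq]
  by_cases hij : i = j <;> by_cases hkl : k = l <;> by_cases hik : i = k <;>
    by_cases hjl : j = l <;> simp_all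
  · ring
  · ring
  · linear_combination -(d - n : ℂ) * (√(x l) ^ 2 * hxx k + x k * hxx l)

theorem twirl_tensor (hn : 1 ≤ n) (e f : Fin d → ℝ) :
    SchmidtNumberLE (Matrix.of fun p q : Fin d × Fin d =>
      if (p.1 = p.2 ∧ q.1 = q.2) ∨ p = q then ((e p.1 * f p.2 * (e q.1 * f q.2) : ℝ) : ℂ)
      else 0) n := by
  convert (of_sum_tensor (n := n) {()} (by simpa using hn) (fun _ i => (e i : ℂ))
    (fun _ i => (f i : ℂ)) rfl).twirl using 1
  ext p q
  simp [torusTwirl, vecMulVec_apply]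

theorem mul_le_half_of_sum_sq {s : Fin d → ℝ} (hs : ∑ i, s i ^ 2 = 1) {i j : Fin d}
    (hij : i ≠ j) : 2 * (s i * s j) ≤ 1 := by
  have : ∑ k ∈ {i, j}, s k ^ 2 ≤ ∑ k, s k ^ 2 :=
    Finset.sum_le_sum_of_subset_of_nonneg (Finset.subset_univ _) fun _ _ _ => sq_nonneg _
  rw [Finset.sum_pair hij, hs] at this
  nlinarith [sq_nonneg (s i - s j)]

theorem diagVec_upper_of_eq_one {s : Fin d → ℝ} (hd : 1 ≤ d) (hs0 : ∀ i, 0 ≤ s i)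
    (hs : ∑ i, s i ^ 2 = 1) :
    SchmidtNumberLE (((2 * (d - 1) : ℝ) : ℂ) • vecMulVec (diagVec s) (star (diagVec s)) +
      ((d - 1 : ℝ) : ℂ) • (1 : Matrix (Fin d × Fin d) (Fin d × Fin d) ℂ)) 1 := by
  have hd' : (0 : ℝ) ≤ d - 1 := by
    have : (1 : ℝ) ≤ d := by exact_mod_cast hd
    linarith
  have h1 := (twirl_tensor le_rfl (fun i => √(s i)) (fun i => √(s i))).smul
    (r := 2 * (d - 1)) (by linarith)
  have h2 := diagonal (d := d) le_rfl (w := fun p => if p.1 = p.2 then (d - 1 : ℝ) else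
    (d - 1) * (1 - 2 * (s p.1 * s p.2))) fun p => by
      split_ifs with h
      · exact hd'
      · exact mul_nonneg hd' (by linarith [mul_le_half_of_sum_sq hs h])
  convert h1.add h2 using 1
  ext ⟨i, j⟩ ⟨k, l⟩
  simp only [vecMulVec_diagVec, Matrix.add_apply, Matrix.smul_apply, of_apply, smul_eq_mul,
    Matrix.one_apply, Matrix.diagonal_apply, Prod.mk.injEq]
  push_cast
  have hss (i k) : (√(s i) * √(s i) * (√(s k) * √(s k)) : ℂ) = s i * s k := by
    norm_cast
    rw [Real.mul_self_sqrt (hs0 i), Real.mul_self_sqrt (hs0 k)]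
  by_cases hij : i = j <;> by_cases hkl : k = l <;> by_cases hik : i = k <;>
    by_cases hjl : j = l <;> simp_all
  rw [mul_mul_mul_comm (√(s k) : ℂ), hss]
  ring

theorem diagVec_upper_of_le (hn : 2 ≤ n) (hnd : n ≤ d) {s : Fin d → ℝ} (hs0 : ∀ i, 0 ≤ s i)
    (hs : ∑ i, s i ^ 2 = 1) (hle : ∀ i, 2 * s i ^ 2 ≤ 1) :
    SchmidtNumberLE (((2 * (d * n - 1) : ℝ) : ℂ) • vecMulVec (diagVec s) (star (diagVec s)) +
      ((d - n : ℝ) : ℂ) • (1 : Matrix (Fin d × Fin d) (Fin d × Fin d) ℂ)) n := by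
  have hK : (0 : ℝ) ≤ d - n := sub_nonneg.2 (by exact_mod_cast hnd)
  have h1 := (filtered_isotropic hn hnd hs0).smul (r := 2) zero_le_two
  have h2 := diagonal (d := d) (n := n) (by omega)
    (w := fun p => (d - n : ℝ) * (1 - 2 * (s p.1 * s p.2))) fun p => by
      refine mul_nonneg hK ?_
      by_cases h : p.1 = p.2
      · rw [h]
        linarith [hle p.2, sq (s p.2)]
      · linarith [mul_le_half_of_sum_sq hs h]
  convert h1.add h2 using 1
  ext p q
  simp only [vecMulVec_diagVec, Matrix.add_apply, Matrix.smul_apply, smul_eq_mul,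
    Matrix.one_apply, Matrix.diagonal_apply]
  push_cast
  by_cases hpq : p = q
  · simp only [hpq, if_true]
    ring
  · simp only [hpq, if_false]
    ring

/-- When one Schmidt coefficient `s o` dominates, lower it so that the filtered isotropic state fits,
and restore the row and column of `o` using vectors supported on `{o, j}`. -/
theorem diagVec_upper_of_lt (hn : 2 ≤ n) (hnd : n < d) {s : Fin d → ℝ} (hs0 : ∀ i, 0 ≤ s i)
    (hs : ∑ i, s i ^ 2 = 1) {o : Fin d} (ho : 1 < 2 * s o ^ 2) :
    SchmidtNumberLE (((2 * (d * n - 1) : ℝ) : ℂ) • vecMulVec (diagVec s) (star (diagVec s)) +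
      ((d - n : ℝ) : ℂ) • (1 : Matrix (Fin d × Fin d) (Fin d × Fin d) ℂ)) n := by
  have hn' : (2 : ℝ) ≤ n := by exact_mod_cast hn
  have hnd' : (n : ℝ) < d := by exact_mod_cast hnd
  set K : ℝ := d - n with hKdef
  set N : ℝ := d * n - 1 with hNdef
  have hK : 0 < K := by linarith
  have hKN : K ≤ N := by nlinarith
  have hN : 0 < N := by linarith
  set t : ℝ := s o ^ 2 - 1 / 2 with ht
  obtain ⟨c, hc⟩ : ∃ c, c * N = K := ⟨K / N, div_mul_cancel₀ _ hN.ne'⟩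
  have hc0 : 0 < c := by
    by_contra! h
    nlinarith
  have hc1 : c ≤ 1 := by
    by_contra! h
    nlinarith
  have hrest (i) (hi : i ≠ o) : s i ^ 2 + s o ^ 2 ≤ 1 := by
    rw [← hs, ← Finset.sum_pair (f := fun j => s j ^ 2) hi]
    exact Finset.sum_le_sum_of_subset_of_nonneg (Finset.subset_univ _) fun _ _ _ => sq_nonneg _
  have herase : ∑ j ∈ Finset.univ.erase o, s j ^ 2 = 1 - s o ^ 2 := by
    rw [← hs, ← Finset.add_sum_erase _ _ (Finset.mem_univ o)]
    ring
  have hso : s o ^ 2 ≤ 1 := by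
    have : 0 ≤ ∑ j ∈ Finset.univ.erase o, s j ^ 2 := Finset.sum_nonneg fun _ _ => sq_nonneg _
    linarith
  have ht0 : 0 < t := by linarith
  have ht1 : t ≤ 1 / 2 := by linarith
  set r : ℝ := 1 - 2 * c * t with hr
  have hr0 : 0 ≤ r := by nlinarith
  have hr1 : r ≤ 1 := by nlinarith
  let x (i : Fin d) : ℝ := if i = o then r * s o else s i
  let y (j i : Fin d) : ℝ := if i = o then 2 * s o * s j else if i = j then 1 else 0
  have hx0 (i) : 0 ≤ x i := by
    simp only [x]
    split_ifs
    exacts [mul_nonneg hr0 (hs0 o), hs0 i]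
  have hxs (i) : x i ≤ s i := by
    simp only [x]
    split_ifs with h
    · rw [h]
      exact mul_le_of_le_one_left (hs0 o) hr1
    · exact le_rfl
  have hyy (i k : Fin d) : ∑ j ∈ Finset.univ.erase o, y j i * y j k =
      if i = o then if k = o then 4 * s o ^ 2 * (1 - s o ^ 2) else 2 * s o * s k
      else if k = o then 2 * s o * s i else if i = k then 1 else 0 := by
    by_cases hi : i = o <;> by_cases hk : k = o
    · simp only [y, hi, hk, if_true, ← herase, Finset.mul_sum]
      exact Finset.sum_congr rfl fun j _ => by ring
    · simp [y, hi, hk]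
    · simp [y, hi, hk]
    · simp [y, hi, hk]
  have h1 := (filtered_isotropic hn hnd.le hx0).smul (r := 2) zero_le_two
  have h2 := (sum (Finset.univ.erase o) fun j _ => of_diagVec (n := n) {o, j}
    (Finset.card_le_two.trans hn) (x := y j) (by simp +contextual [y])).smul
    (r := 2 * K * t) (by positivity)
  have h3 := diagonal (d := d) (n := n) (by omega) (w := fun p =>
    if p.1 = p.2 then
      if p.1 = o then 2 * N * s o ^ 2 + K - 2 * N * (r * s o) ^ 2 - 2 * K * (r * s o) ^ 2 -
        2 * K * t * (4 * s o ^ 2 * (1 - s o ^ 2))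
      else K - 2 * K * s p.1 ^ 2 - 2 * K * t
    else K - 2 * K * (x p.1 * x p.2)) fun p => by
      split_ifs with hp hpo
      · have : 2 * N * s o ^ 2 + K - 2 * N * (r * s o) ^ 2 - 2 * K * (r * s o) ^ 2 -
            2 * K * t * (4 * s o ^ 2 * (1 - s o ^ 2)) =
            2 * K * t * (4 * (s o ^ 2) ^ 2 - 1 + 4 * s o ^ 2 * c * (1 - t - c * t)) := by
          have hs' : s o ^ 2 = t + 1 / 2 := by rw [ht]; ring
          simp only [mul_pow, hs', hr, ← hc]
          ring
        rw [this]
        have : 0 ≤ 1 - t - c * t := by nlinarith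
        have : 0 ≤ 4 * s o ^ 2 * c * (1 - t - c * t) := by positivity
        have : 0 ≤ 4 * (s o ^ 2) ^ 2 - 1 := by nlinarith
        exact mul_nonneg (by positivity) (by linarith)
      · have : 0 ≤ K * (1 - 2 * s p.1 ^ 2 - 2 * t) :=
          mul_nonneg hK.le (by linarith [hrest _ hpo])
        linarith
      · have : x p.1 * x p.2 ≤ s p.1 * s p.2 := mul_le_mul (hxs _) (hxs _) (hx0 _) (hs0 _)
        have : 0 ≤ K * (1 - 2 * (x p.1 * x p.2)) :=
          mul_nonneg hK.le (by linarith [mul_le_half_of_sum_sq hs hp])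
        linarith
  convert (h1.add h2).add h3 using 1
  ext ⟨i, j⟩ ⟨k, l⟩
  have hKc : (d - n : ℂ) = (K : ℝ) := by simp [K]
  have hNc : (d * n - 1 : ℂ) = (N : ℝ) := by simp [N]
  simp only [Matrix.add_apply, Matrix.smul_apply, smul_eq_mul, Matrix.sum_apply,
    vecMulVec_diagVec, Matrix.one_apply, Matrix.diagonal_apply, hKc, hNc, Prod.mk.injEq]
  by_cases hij : i = j
  · subst hij
    by_cases hkl : k = l
    · subst hkl
      simp only [and_self, if_true, ← Complex.ofReal_sum, hyy]
      have hkey : N * r = N - 2 * K * t := by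
        rw [hr, ← hc]
        ring
      by_cases hi : i = o <;> by_cases hk : k = o
      · simp only [x, hi, hk, if_true]
        norm_cast
        ring
      · have hki : ¬ o = k := Ne.symm hk
        simp only [x, hi, hk, hki, if_true, if_false]
        norm_cast
        linear_combination (- 2 * s o * s k) * hkey
      · simp only [x, hi, hk, if_true, if_false]
        norm_cast
        linear_combination (- 2 * s o * s i) * hkey
      · by_cases hik : i = k
        · subst hik
          simp only [x, hi, if_true, if_false]
          norm_cast
          ring
        · simp only [x, hi, hk, hik, if_false]
          norm_cast
          ring
    · have : ¬ (i = k ∧ i = l) := fun h => hkl (h.1.symm.trans h.2)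
      simp [hkl, this]
  · by_cases h : i = k ∧ j = l
    · simp only [h, and_self, if_true]
      rw [← h.1, ← h.2]
      simp only [hij, if_false, Finset.sum_const_zero]
      norm_cast
      ring
    · simp [hij, h]

theorem diagVec_upper (hn : 1 ≤ n) (hnd : n < d) {s : Fin d → ℝ} (hs0 : ∀ i, 0 ≤ s i)
    (hs : ∑ i, s i ^ 2 = 1) :
    SchmidtNumberLE (((2 * (d * n - 1) : ℝ) : ℂ) • vecMulVec (diagVec s) (star (diagVec s)) +
      ((d - n : ℝ) : ℂ) • (1 : Matrix (Fin d × Fin d) (Fin d × Fin d) ℂ)) n := by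
  obtain rfl | hn := hn.eq_or_lt
  · simpa using diagVec_upper_of_eq_one hnd.le hs0 hs
  by_cases h : ∀ i, 2 * s i ^ 2 ≤ 1
  · exact diagVec_upper_of_le hn hnd.le hs0 hs h
  · push Not at h
    obtain ⟨o, ho⟩ := h
    exact diagVec_upper_of_lt hn hnd hs0 hs ho

theorem diagVec_lower (hn : 1 ≤ n) {s : Fin d → ℝ} (hs0 : ∀ i, 0 ≤ s i)
    (hs : ∑ i, s i ^ 2 = 1) :
    SchmidtNumberLE ((1 : Matrix (Fin d × Fin d) (Fin d × Fin d) ℂ) -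
      vecMulVec (diagVec s) (star (diagVec s))) n := by
  let a (i : Fin d) : ℝ := √(s i)
  have ha (i) : a i * a i = s i := Real.mul_self_sqrt (hs0 i)
  let e (i j p : Fin d) : ℝ := (if i = p then a j else 0) + if j = p then a i else 0
  let f (i j p : Fin d) : ℝ := (if i = p then a j else 0) - if j = p then a i else 0
  have hef (i j p) : e i j p * f i j p = (if i = p then s j else 0) - if j = p then s i else 0 := by
    by_cases hi : i = p <;> by_cases hj : j = p <;> simp [e, f, hi, hj, ha]
  have hdiag (p q) : ∑ i, ∑ j, e i j p * f i j p * (e i j q * f i j q) =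
      2 * ((if p = q then 1 else 0) - s p * s q) := by
    simp only [hef, sub_mul, mul_sub, Finset.sum_sub_distrib, ite_mul, mul_ite, zero_mul, mul_zero]
    by_cases hpq : p = q
    · simp [hpq, ← hs, sq]
      ring
    · simp [hpq, Ne.symm hpq]
      ring
  have hoff (p q) (hpq : p ≠ q) : ∑ i, ∑ j, e i j p * f i j q * (e i j p * f i j q) =
      2 * (s p * s q) := by
    have hij (i j) : e i j p * f i j q * (e i j p * f i j q) =
        (if i = p then if j = q then s p * s q else 0 else 0) +
          if i = q then if j = p then s p * s q else 0 else 0 := by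
      by_cases hip : i = p
      · subst hip
        by_cases hjq : j = q
        · subst hjq
          simp [e, f, hpq, Ne.symm hpq]
          linear_combination a j * a j * ha i + s i * ha j
        · simp [f, hpq, hjq]
      · by_cases hjp : j = p
        · subst hjp
          by_cases hiq : i = q
          · subst hiq
            simp [e, f, hip, Ne.symm hip]
            linear_combination a j * a j * ha i + s i * ha j
          · simp [f, hpq, hiq, hip]
        · simp [e, hip, hjp]
    simp only [hij, Finset.sum_add_distrib]
    simp
    ring
  have h1 := (sum Finset.univ fun i _ => sum Finset.univ fun j _ =>
    twirl_tensor hn (e i j) (f i j)).smul (r := 1 / 2) (by norm_num)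
  have h2 := diagonal (d := d) hn (w := fun p => if p.1 = p.2 then 0 else 1 - s p.1 * s p.2)
    fun p => by
      split_ifs with h
      · exact le_rfl
      · linarith [mul_le_half_of_sum_sq hs h, mul_nonneg (hs0 p.1) (hs0 p.2)]
  convert h1.add h2 using 1
  ext ⟨i, j⟩ ⟨k, l⟩
  simp only [Matrix.add_apply, Matrix.sub_apply, Matrix.smul_apply, smul_eq_mul, Matrix.sum_apply,
    of_apply, vecMulVec_diagVec, Matrix.one_apply, Matrix.diagonal_apply, Prod.mk.injEq]
  by_cases hij : i = j
  · subst hij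
    by_cases hkl : k = l
    · subst hkl
      simp only [and_self, true_or, if_true, ← Complex.ofReal_sum, hdiag]
      by_cases hik : i = k <;> simp [hik]
    · have : ¬ (i = k ∧ i = l) := fun h => hkl (h.1.symm.trans h.2)
      simp [hkl, this]
  · by_cases h : i = k ∧ j = l
    · obtain ⟨rfl, rfl⟩ := h
      simp only [hij, and_self, or_true, if_true, if_false, ← Complex.ofReal_sum, hoff i j hij]
      push_cast
      ring
    · simp [hij, h]

theorem one_add_smul_diagVec (hn : 1 ≤ n) (hnd : n < d) {s : Fin d → ℝ} (hs0 : ∀ i, 0 ≤ s i)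
    (hs : ∑ i, s i ^ 2 = 1) {α : ℝ} (hα1 : -1 ≤ α) (hα2 : α ≤ 2 * (d * n - 1) / (d - n)) :
    SchmidtNumberLE ((1 : Matrix (Fin d × Fin d) (Fin d × Fin d) ℂ) +
      (α : ℂ) • vecMulVec (diagVec s) (star (diagVec s))) n := by
  have hn' : (1 : ℝ) ≤ n := by exact_mod_cast hn
  have hnd' : (n : ℝ) < d := by exact_mod_cast hnd
  have hK : 0 < (d - n : ℝ) := by linarith
  have hN : 0 < 2 * (d * n - 1 : ℝ) := by nlinarith
  rw [le_div_iff₀ hK] at hα2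
  set K : ℝ := d - n with hKdef
  set N : ℝ := 2 * (d * n - 1) with hNdef
  have h1 := (diagVec_upper hn hnd hs0 hs).smul (r := (1 + α) / (N + K))
    (div_nonneg (by linarith) (by linarith))
  have h2 := (diagVec_lower hn hs0 hs).smul (r := (N - α * K) / (N + K))
    (div_nonneg (by linarith) (by linarith))
  rw [← hKdef, ← hNdef] at h1
  have hNK : ((N : ℂ) + K) ≠ 0 := by
    norm_cast
    linarith
  convert h1.add h2 using 1
  ext p q
  simp only [Matrix.add_apply, Matrix.sub_apply, Matrix.smul_apply, smul_eq_mul]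
  push_cast
  field_simp
  ring

theorem exists_singular_value_decomposition (A : Matrix (Fin d) (Fin d) ℂ) :
    ∃ U ∈ unitaryGroup (Fin d) ℂ, ∃ V ∈ unitaryGroup (Fin d) ℂ, ∃ s : Fin d → ℝ,
      (∀ i, 0 ≤ s i) ∧ A = U * Matrix.diagonal (fun i => (s i : ℂ)) * V := by
  have hA : (Aᴴ * A).PosSemidef := posSemidef_conjTranspose_mul_self A
  set V := hA.isHermitian.eigenvectorUnitary
  set lam := hA.isHermitian.eigenvalues
  have hlam (i) : 0 ≤ lam i := hA.eigenvalues_nonneg i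
  set B := A * (V : Matrix (Fin d) (Fin d) ℂ) with hB
  have hBB : Bᴴ * B = Matrix.diagonal fun i => (lam i : ℂ) := by
    have := hA.isHermitian.conjStarAlgAut_star_eigenvectorUnitary
    rw [Unitary.conjStarAlgAut_star_apply] at this
    rw [hB, conjTranspose_mul, ← star_eq_conjTranspose (V : Matrix (Fin d) (Fin d) ℂ),
      Matrix.mul_assoc, ← Matrix.mul_assoc Aᴴ, ← Matrix.mul_assoc]
    exact this
  have hcol (i j) : ∑ k, star (B k i) * B k j = if i = j then (lam i : ℂ) else 0 := by
    rw [← Matrix.diagonal_apply (d := fun i => (lam i : ℂ)), ← hBB]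
    rfl
  let u (j : Fin d) : EuclideanSpace ℂ (Fin d) :=
    WithLp.toLp 2 fun i => (√(lam j) : ℂ)⁻¹ * B i j
  have hu : Orthonormal ℂ (({j | lam j ≠ 0} : Set (Fin d)).domRestrict u) := by
    rw [orthonormal_iff_ite]
    rintro ⟨i, hi⟩ ⟨j, hj⟩
    have hi' : (√(lam i) : ℂ) ≠ 0 := by
      exact_mod_cast (Real.sqrt_ne_zero (hlam i)).2 hi
    have hsq : (√(lam i) : ℂ) * √(lam i) = lam i := by
      rw [← Complex.ofReal_mul, Real.mul_self_sqrt (hlam i)]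
    have : inner ℂ (u i) (u j) =
        (√(lam i) : ℂ)⁻¹ * (√(lam j) : ℂ)⁻¹ * ∑ k, star (B k i) * B k j := by
      rw [PiLp.inner_apply, Finset.mul_sum]
      refine Finset.sum_congr rfl fun k _ => ?_
      simp [u]
      ring
    refine this.trans ?_
    rw [hcol]
    by_cases hij : i = j
    · subst hij
      simp [← hsq]
      field_simp
    · simp [hij]
  obtain ⟨b, hb⟩ := hu.exists_orthonormalBasis_extension_of_card_eq (by simp)
  refine ⟨_, (EuclideanSpace.basisFun (Fin d) ℂ).toMatrix_orthonormalBasis_mem_unitary b,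
    _, (star V).2, fun i => √(lam i), fun i => Real.sqrt_nonneg _, ?_⟩
  have hBU : B = (EuclideanSpace.basisFun (Fin d) ℂ).toBasis.toMatrix b *
      Matrix.diagonal fun i => (√(lam i) : ℂ) := by
    ext i j
    rw [mul_diagonal]
    by_cases hj : lam j = 0
    · have := hcol j j
      simp only [if_true, hj, Complex.ofReal_zero] at this
      have hBj : B.col j = 0 := dotProduct_star_self_eq_zero.1 this
      simpa [hj] using congr_fun hBj i
    · have hj' : (√(lam j) : ℂ) ≠ 0 := by
        exact_mod_cast (Real.sqrt_ne_zero (hlam j)).2 hj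
      simp [Module.Basis.toMatrix_apply, hb j hj, u]
      field_simp
  rw [← hBU, hB, Matrix.mul_assoc]
  simp

/-- Schmidt decomposition of a bipartite vector. -/
theorem exists_schmidt_decomposition (v : Fin d × Fin d → ℂ) :
    ∃ U ∈ unitaryGroup (Fin d) ℂ, ∃ W ∈ unitaryGroup (Fin d) ℂ, ∃ s : Fin d → ℝ,
      (∀ i, 0 ≤ s i) ∧ v = kroneckerMap (· * ·) U W *ᵥ diagVec s := by
  obtain ⟨U, hU, V, hV, s, hs, h⟩ := exists_singular_value_decomposition (of fun i j => v (i, j))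
  refine ⟨U, hU, Vᵀ, transpose_mem_unitaryGroup_iff.2 hV, s, hs, ?_⟩
  ext ⟨i, j⟩
  have := congr_fun₂ h i j
  rw [mul_apply] at this
  simp only [of_apply, mul_diagonal] at this
  simp [this, mulVec, dotProduct, Fintype.sum_prod_type, diagVec, mul_right_comm]

theorem one_add_smul_vecMulVec (hn : 1 ≤ n) (hnd : n < d) {v : Fin d × Fin d → ℂ}
    (hv : v ⬝ᵥ star v = 1) {α : ℝ} (hα1 : -1 ≤ α) (hα2 : α ≤ 2 * (d * n - 1) / (d - n)) :
    SchmidtNumberLE ((1 : Matrix (Fin d × Fin d) (Fin d × Fin d) ℂ) +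
      (α : ℂ) • vecMulVec v (star v)) n := by
  obtain ⟨U, hU, W, hW, s, hs0, rfl⟩ := exists_schmidt_decomposition v
  have hUW : kroneckerMap (· * ·) U W ∈ unitaryGroup (Fin d × Fin d) ℂ :=
    kronecker_mem_unitary hU hW
  set X := kroneckerMap (· * ·) U W
  have hs : ∑ i, s i ^ 2 = 1 := by
    rw [star_mulVec, dotProduct_comm, ← dotProduct_mulVec, mulVec_mulVec,
      ← star_eq_conjTranspose, mem_unitaryGroup_iff'.1 hUW, one_mulVec] at hv
    have : (∑ i, s i ^ 2 : ℂ) = 1 := by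
      simpa [dotProduct, Fintype.sum_prod_type, diagVec, sq, apply_ite] using hv
    exact_mod_cast this
  convert (one_add_smul_diagVec hn hnd hs0 hs hα1 hα2).kronecker_conj U W using 1
  change _ = X * _ * Xᴴ
  rw [Matrix.mul_add, Matrix.add_mul, Matrix.mul_one, ← star_eq_conjTranspose,
    mem_unitaryGroup_iff.1 hUW, star_eq_conjTranspose, Matrix.mul_smul, Matrix.smul_mul,
    mul_vecMulVec, vecMulVec_mul, star_mulVec]

theorem dotProduct_add_smul_vecMulVec (hn : 1 ≤ n) (hnd : n < d) (v : Fin d × Fin d → ℂ)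
    {α : ℝ} (hα1 : -1 ≤ α) (hα2 : α ≤ 2 * (d * n - 1) / (d - n)) :
    SchmidtNumberLE ((v ⬝ᵥ star v) • (1 : Matrix (Fin d × Fin d) (Fin d × Fin d) ℂ) +
      (α : ℂ) • vecMulVec v (star v)) n := by
  by_cases hv : v = 0
  · simpa [hv] using zero
  have hpos : 0 < v ⬝ᵥ star v := dotProduct_self_star_pos_iff.2 hv
  obtain ⟨r, hr⟩ : ∃ r : ℝ, (r : ℂ) = v ⬝ᵥ star v := ⟨_, (Complex.eq_re_of_ofReal_le hpos.le).symm⟩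
  have hr0 : 0 < r := by
    rw [← hr] at hpos
    exact_mod_cast hpos
  have hrr : (√r : ℂ) * √r = r := by
    rw [← Complex.ofReal_mul, Real.mul_self_sqrt hr0.le]
  have hr' : (√r : ℂ) ≠ 0 := by
    exact_mod_cast (Real.sqrt_pos.2 hr0).ne'
  have h := (one_add_smul_vecMulVec hn hnd (v := (√r : ℂ)⁻¹ • v) (by
    simp [← hr, ← hrr]
    field_simp) hα1 hα2).smul hr0.le
  convert h using 1
  rw [← hr]
  ext p q
  simp [vecMulVec_apply, ← hrr]
  field_simp

end SchmidtNumberLE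

theorem stmt17 {d n : ℕ} (hd : 2 ≤ d) (hn : 1 ≤ n) (hnd : n < d)
    (ρ : Matrix (Fin d × Fin d) (Fin d × Fin d) ℂ) (hρ : ρ.PosSemidef)
    (α : ℝ) (hα1 : -1 ≤ α)
    (hα2 : α ≤ 2 * ((d : ℝ) * (n : ℝ) - 1) / ((d : ℝ) - (n : ℝ))) :
    SchmidtNumberLE
      (ρ.trace • (1 : Matrix (Fin d × Fin d) (Fin d × Fin d) ℂ) + (α : ℂ) • ρ) n := by
  obtain ⟨m, v, rfl⟩ := posSemidef_iff_eq_sum_vecMulVec.1 hρ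
  simp only [trace_sum, trace_vecMulVec, Finset.sum_smul, Finset.smul_sum,
    ← Finset.sum_add_distrib]
  exact SchmidtNumberLE.sum _ fun i _ =>
    SchmidtNumberLE.dotProduct_add_smul_vecMulVec hn hnd (v i) hα1 hα2
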